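/- arXiv:1710.02858 — 7 statements merged into one kernel-verified Lean document; each statement's English description precedes it below -/
import Mathlib

section
/- Let P be a poset and let (p_i)_{i∈𝒥} be a family of maximal elements of P. Then every maximal element p of the set {q ∈ P : q ≤ p_i for all i ∈ 𝒥} satisfies Λp = p for every translation Λ on P; that is, p is a fixed point of P. -/
/-- Let `P` be a poset and `(p i)_{i ∈ ι}` a family of maximal elements
of `P`.  Every maximal element `q` of `{r ∈ P : r ≤ p i for all i}` satisfies `Λ q = q`
for every translation `Λ` on `P` (a monotone map with `x ≤ Λ x` for all `x`); that is,
`q` is a fixed point of `P`. -/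
theorem statement0 {P : Type*} [PartialOrder P] {ι : Type*} (p : ι → P)
    (hmax : ∀ i, IsMax (p i)) (q : P)
    (hq : ∀ i, q ≤ p i)
    (hqmax : ∀ r : P, (∀ i, r ≤ p i) → q ≤ r → r = q)
    (Λ : P → P) (hmono : Monotone Λ) (hle : ∀ x, x ≤ Λ x) :
    Λ q = q :=
  hqmax (Λ q) (fun i => (hmono (hq i)).trans (hmax i (hle (p i)))) (hle q)
end

section
/- Let P be a finite connected poset (any two elements of P can be joined by a finite sequence of elements of P in which consecutive elements are comparable). Then the following are equivalent: (i) P has a unique minimal element m and the interval [m, M] is totally ordered for every maximal element M of P; (ii) every nonempty connected interval-convex subset of P has a unique minimal element. -/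
namespace GPM

/-- A subset `S` is connected if any two of its elements can be joined by a finite
sequence of elements of `S` in which consecutive elements are comparable. -/
def ConnectedIn {Q : Type*} [Preorder Q] (S : Set Q) : Prop :=
  ∀ x ∈ S, ∀ y ∈ S,
    Relation.ReflTransGen (fun a b => a ∈ S ∧ b ∈ S ∧ (a ≤ b ∨ b ≤ a)) x y

/-- If any two elements with a common upper bound are comparable, then a minimal element of a
connected set is its least element. -/
lemma ConnectedIn.le_of_minimal {P : Type*} [PartialOrder P]
    (hP : ∀ x y z : P, x ≤ z → y ≤ z → x ≤ y ∨ y ≤ x) {S : Set P} (hS : ConnectedIn S)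
    {a b : P} (ha : a ∈ S) (hmin : ∀ c ∈ S, c ≤ a → c = a) (hb : b ∈ S) : a ≤ b := by
  induction hS a ha b hb with
  | refl => exact le_rfl
  | tail _ hcd ih =>
    obtain ⟨hc, hd, hle | hle⟩ := hcd
    · exact (ih hc).trans hle
    · obtain h | h := hP _ _ _ (ih hc) hle
      · exact h
      · exact (hmin _ hd h).ge

/-- A set all of whose elements lie below one of its elements is connected. -/
lemma connectedIn_of_isGreatest {P : Type*} [Preorder P] {S : Set P} {M : P}
    (hM : IsGreatest S M) : ConnectedIn S := fun _ hx _ hy =>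
  (Relation.ReflTransGen.single ⟨hx, hM.1, Or.inl (hM.2 hx)⟩).tail
    ⟨hM.1, hy, Or.inr (hM.2 hy)⟩

/-- If every nonempty connected interval-convex subset has a unique minimal element, then two
elements with a common upper bound are comparable. -/
lemma le_or_le_of_unique_minimal {P : Type*} [PartialOrder P]
    (h : ∀ S : Set P, S.Nonempty → ConnectedIn S → S.OrdConnected →
      ∃! a : P, a ∈ S ∧ ∀ b ∈ S, b ≤ a → b = a)
    {x y M : P} (hx : x ≤ M) (hy : y ≤ M) : x ≤ y ∨ y ≤ x := by
  by_contra! hxy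
  have hM : IsGreatest {z | (x ≤ z ∨ y ≤ z) ∧ z ≤ M} M :=
    ⟨⟨Or.inl hx, le_rfl⟩, fun _ hz => hz.2⟩
  have hconv : Set.OrdConnected {z | (x ≤ z ∨ y ≤ z) ∧ z ≤ M} :=
    ⟨fun _ hu _ hv _ hw => ⟨hu.1.imp hw.1.trans' hw.1.trans', hw.2.trans hv.2⟩⟩
  refine hxy.1 ((h _ hM.nonempty (connectedIn_of_isGreatest hM) hconv).unique
    ⟨⟨Or.inl le_rfl, hx⟩, fun b hb hbx => ?_⟩ ⟨⟨Or.inr le_rfl, hy⟩, fun b hb hby => ?_⟩).le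
  · exact hb.1.elim hbx.antisymm fun hyb => (hxy.2 (hyb.trans hbx)).elim
  · exact hb.1.elim (fun hxb => (hxy.1 (hxb.trans hby)).elim) hby.antisymm

/-- For a finite connected poset `P`, the following are equivalent:
(i) `P` has a unique minimal element `m` and `[m, M]` is totally ordered for every
maximal `M`; (ii) every nonempty connected interval-convex subset of `P` has a unique
minimal element. -/
theorem statement2 {P : Type*} [PartialOrder P] [Finite P] [Nonempty P]
    (hPconn : ConnectedIn (Set.univ : Set P)) :
    (∃ m : P, IsMin m ∧ (∀ p : P, IsMin p → p = m) ∧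
        ∀ M : P, IsMax M → ∀ x ∈ Set.Icc m M, ∀ y ∈ Set.Icc m M, x ≤ y ∨ y ≤ x)
    ↔ (∀ S : Set P, S.Nonempty → ConnectedIn S → S.OrdConnected →
        ∃! a : P, a ∈ S ∧ ∀ b ∈ S, b ≤ a → b = a) := by
  constructor
  · rintro ⟨m, -, hm, hchain⟩ S hne hS -
    have hbot : ∀ p : P, m ≤ p := fun p => by
      obtain ⟨q, hqp, hq⟩ := Finite.exists_le_minimal (p := fun _ : P => True) (a := p) trivial
      exact hm q (minimal_true.1 hq) ▸ hqp
    have hP : ∀ x y z : P, x ≤ z → y ≤ z → x ≤ y ∨ y ≤ x := fun x y z hx hy => by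
      obtain ⟨M, hzM, hM⟩ := Finite.exists_le_maximal (p := fun _ : P => True) (a := z) trivial
      exact hchain M (maximal_true.1 hM) x ⟨hbot x, hx.trans hzM⟩ y ⟨hbot y, hy.trans hzM⟩
    obtain ⟨a, ha⟩ := S.toFinite.exists_minimal hne
    have hmin : ∀ b ∈ S, b ≤ a → b = a := fun b hb hba => hba.antisymm (ha.2 hb hba)
    exact ⟨a, ⟨ha.1, hmin⟩, fun b hb => (hb.2 a ha.1 (hS.le_of_minimal hP ha.1 hmin hb.1)).symm⟩
  · intro h
    obtain ⟨m, ⟨-, hm⟩, huniq⟩ := h Set.univ Set.univ_nonempty hPconn Set.ordConnected_univ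
    exact ⟨m, fun b hb => (hm b trivial hb).ge,
      fun p hp => huniq p ⟨trivial, fun b _ hb => hp.eq_of_le hb⟩,
      fun M _ x hx y hy => le_or_le_of_unique_minimal h hx.2 hy.2⟩

end GPM
end

section
/- Let P be a poset with a unique minimal element m, let Λ be a translation on P with Λm = m, and let S ⊆ P be a nonempty connected interval-convex subset with m ∈ S. Then the preimage {p ∈ P : Λp ∈ S} is a nonempty connected interval-convex subset of P containing m. (Equivalently, for the convex representation J with support S, the representation JΛ : p ↦ J(Λp) is again convex.) -/
namespace GPM

/-- A translation on a preorder: a monotone map `Λ` with `x ≤ Λ x` for all `x`. -/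
structure Translation (Q : Type*) [Preorder Q] where
  toFun : Q → Q
  mono : Monotone toFun
  le_apply : ∀ x, x ≤ toFun x

theorem le_of_forall_isMin_eq {P : Type*} [PartialOrder P] [Finite P] {m : P}
    (h : ∀ p : P, IsMin p → p = m) (p : P) : m ≤ p := by
  obtain ⟨b, hbp, hb⟩ := (Set.toFinite (Set.univ : Set P)).exists_le_minimal (Set.mem_univ p)
  have hmin : IsMin b := fun _ hc => hb.2 (Set.mem_univ _) hc
  exact h b hmin ▸ hbp

/-- A set containing a lower bound of itself is connected. -/
theorem ConnectedIn.of_isLeast {Q : Type*} [Preorder Q] {S : Set Q} {m : Q}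
    (h : IsLeast S m) : ConnectedIn S := fun _ hx _ hy =>
  (Relation.ReflTransGen.single ⟨hx, h.1, Or.inr (h.2 hx)⟩).tail ⟨h.1, hy, Or.inl (h.2 hy)⟩

/-- Let `P` be a (finite) poset with a unique minimal element `m`, let
`Λ` be a translation with `Λ m = m`, and let `S` be a nonempty connected interval-convex
subset with `m ∈ S`.  Then the preimage `{p | Λ p ∈ S}` is a nonempty connected
interval-convex subset containing `m`. -/
theorem statement3 {P : Type*} [PartialOrder P] [Finite P] (m : P)
    (hm : IsMin m) (hmuniq : ∀ p : P, IsMin p → p = m)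
    (Λ : Translation P) (hΛm : Λ.toFun m = m)
    (S : Set P) (hSne : S.Nonempty) (hSconn : ConnectedIn S) (hSconv : S.OrdConnected)
    (hmS : m ∈ S) :
    {p : P | Λ.toFun p ∈ S}.Nonempty ∧ ConnectedIn {p : P | Λ.toFun p ∈ S} ∧
      Set.OrdConnected {p : P | Λ.toFun p ∈ S} ∧ m ∈ {p : P | Λ.toFun p ∈ S} := by
  have hmem : m ∈ {p : P | Λ.toFun p ∈ S} := by
    simpa [hΛm] using hmS
  exact ⟨⟨m, hmem⟩, .of_isLeast ⟨hmem, fun p _ => le_of_forall_isMin_eq hmuniq p⟩,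
    hSconv.preimage_mono Λ.mono, hmem⟩

end GPM
end

section
/- Let P be an n-Vee, let P⁺ denote P with a new greatest element ∞ adjoined, let Λ be a translation on P⁺, and let S ⊆ P be a nonempty connected interval-convex subset. Then the set {p ∈ P : Λp ∈ S} is either empty or a connected interval-convex subset of P. (Equivalently, for any convex representation I of P, the representation IΛ is either zero or convex.) -/
namespace GPM

/-- `P` is an n-Vee with (unique) minimal element `m`: `m` is the unique minimal element,
the interval `[m, M]` is totally ordered for every maximal element `M`, and
`[m, M] ∩ [m, M'] = {m}` for distinct maximal elements `M, M'`. -/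
structure IsNVee (P : Type*) [PartialOrder P] (m : P) : Prop where
  isMin : IsMin m
  eq_of_isMin : ∀ p : P, IsMin p → p = m
  icc_chain : ∀ M : P, IsMax M → ∀ x ∈ Set.Icc m M, ∀ y ∈ Set.Icc m M, x ≤ y ∨ y ≤ x
  icc_inter : ∀ M M' : P, IsMax M → IsMax M' → M ≠ M' →
      Set.Icc m M ∩ Set.Icc m M' = {m}

theorem exists_isMax_ge {P : Type*} [PartialOrder P] [Finite P] (x : P) :
    ∃ M, x ≤ M ∧ IsMax M := by
  obtain ⟨M, hxM, hM⟩ := Finite.exists_le_maximal (p := fun _ : P => True) (a := x) trivial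
  exact ⟨M, hxM, fun z hz => hM.le_of_ge trivial hz⟩

namespace IsNVee

variable {P : Type*} [PartialOrder P] [Finite P] {m : P}

theorem le (hP : IsNVee P m) (x : P) : m ≤ x := by
  obtain ⟨y, hyx, hy⟩ := Finite.exists_le_minimal (p := fun _ : P => True) (a := x) trivial
  rw [← hP.eq_of_isMin y fun z hz => hy.le_of_le trivial hz]
  exact hyx

theorem comparable_of_le (hP : IsNVee P m) {a b c : P} (hac : a ≤ c) (hbc : b ≤ c) :
    a ≤ b ∨ b ≤ a := by
  obtain ⟨M, hcM, hM⟩ := exists_isMax_ge c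
  exact hP.icc_chain M hM a ⟨hP.le a, hac.trans hcM⟩ b ⟨hP.le b, hbc.trans hcM⟩

theorem comparable_of_ge (hP : IsNVee P m) {a b c : P} (ha : a ≠ m) (hab : a ≤ b)
    (hac : a ≤ c) : b ≤ c ∨ c ≤ b := by
  obtain ⟨M, hbM, hM⟩ := exists_isMax_ge b
  obtain ⟨M', hcM', hM'⟩ := exists_isMax_ge c
  obtain rfl : M = M' := by
    by_contra hne
    have h : a ∈ Set.Icc m M ∩ Set.Icc m M' :=
      ⟨⟨hP.le a, hab.trans hbM⟩, ⟨hP.le a, hac.trans hcM'⟩⟩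
    rw [hP.icc_inter M M' hM hM' hne] at h
    exact ha h
  exact hP.comparable_of_le hbM hcM'

/-- Comparability is transitive away from the minimal element, so a connected subset
avoiding the minimal element is a chain. -/
theorem comparable_of_connectedIn (hP : IsNVee P m) {S : Set P} (hS : ConnectedIn S)
    (hm : m ∉ S) {s t : P} (hs : s ∈ S) (ht : t ∈ S) : s ≤ t ∨ t ≤ s := by
  induction hS s hs t ht with
  | refl => exact .inl le_rfl
  | @tail x y _ hxy ih =>
    obtain ⟨hx, hy, hxy⟩ := hxy
    have hxm : x ≠ m := fun h => hm (h ▸ hx)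
    rcases ih hx with hsx | hxs <;> rcases hxy with hxy | hyx
    · exact .inl (hsx.trans hxy)
    · exact hP.comparable_of_le hsx hyx
    · exact hP.comparable_of_ge hxm hxs hxy
    · exact .inr (hyx.trans hxs)

end IsNVee

namespace Translation

variable {P : Type*} [PartialOrder P]

theorem ordConnected_preimage (Λ : Translation (WithTop P)) {S : Set P}
    (hS : S.OrdConnected) : Set.OrdConnected {p : P | ∃ q ∈ S, Λ.toFun ↑p = ↑q} := by
  refine ⟨?_⟩
  rintro x ⟨s, hs, hxs⟩ z ⟨t, ht, hzt⟩ y ⟨hxy, hyz⟩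
  have h₁ := Λ.mono (WithTop.coe_le_coe.2 hxy)
  have h₂ := Λ.mono (WithTop.coe_le_coe.2 hyz)
  rw [hxs] at h₁
  rw [hzt] at h₂
  obtain ⟨u, hu, hut⟩ := WithTop.le_coe_iff.1 h₂
  rw [hu] at h₁
  exact ⟨u, hS.out hs ht ⟨WithTop.coe_le_coe.1 h₁, hut⟩, hu⟩

theorem connectedIn_preimage [Finite P] {m : P} (hP : IsNVee P m)
    (Λ : Translation (WithTop P)) {S : Set P} (hS : ConnectedIn S) :
    ConnectedIn {p : P | ∃ q ∈ S, Λ.toFun ↑p = ↑q} := by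
  rintro p ⟨s, hs, hps⟩ q ⟨t, ht, hqt⟩
  have hp_mem : p ∈ {p : P | ∃ q ∈ S, Λ.toFun ↑p = ↑q} := ⟨s, hs, hps⟩
  have hq_mem : q ∈ {p : P | ∃ q ∈ S, Λ.toFun ↑p = ↑q} := ⟨t, ht, hqt⟩
  by_cases hpq : p ≤ q ∨ q ≤ p
  · exact .single ⟨hp_mem, hq_mem, hpq⟩
  have hp : p ≤ s := WithTop.coe_le_coe.1 (hps ▸ Λ.le_apply p)
  have hq : q ≤ t := WithTop.coe_le_coe.1 (hqt ▸ Λ.le_apply q)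
  have hst : ¬(s ≤ t ∨ t ≤ s) := by
    rintro (h | h)
    · exact hpq (hP.comparable_of_le (hp.trans h) hq)
    · exact hpq (hP.comparable_of_le hp (hq.trans h))
  have hmS : m ∈ S := by
    by_contra hm
    exact hst (hP.comparable_of_connectedIn hS hm hs ht)
  have h₁ := Λ.mono (WithTop.coe_le_coe.2 (hP.le p))
  have h₂ := Λ.mono (WithTop.coe_le_coe.2 (hP.le q))
  rw [hps] at h₁
  rw [hqt] at h₂
  obtain ⟨u, hu, hus⟩ := WithTop.le_coe_iff.1 h₁
  rw [hu] at h₂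
  obtain rfl : u = m := by
    by_contra hum
    exact hst (hP.comparable_of_ge hum hus (WithTop.coe_le_coe.1 h₂))
  have hm_mem : u ∈ {p : P | ∃ q ∈ S, Λ.toFun ↑p = ↑q} := ⟨u, hmS, hu⟩
  exact .tail (.single ⟨hp_mem, hm_mem, .inr (hP.le p)⟩) ⟨hm_mem, hq_mem, .inl (hP.le q)⟩

end Translation

/-- Let `P` be an n-Vee, `Λ` a translation on `P⁺ = P ∪ {∞}` and
`S ⊆ P` a nonempty connected interval-convex subset.  Then `{p ∈ P : Λ p ∈ S}` is
either empty or a connected interval-convex subset of `P`. -/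
theorem statement4 {P : Type*} [PartialOrder P] [Finite P] (m : P) (hP : IsNVee P m)
    (Λ : Translation (WithTop P))
    (S : Set P) (hSne : S.Nonempty) (hSconn : ConnectedIn S) (hSconv : S.OrdConnected) :
    {p : P | ∃ q ∈ S, Λ.toFun ↑p = ↑q} = ∅ ∨
      (ConnectedIn {p : P | ∃ q ∈ S, Λ.toFun ↑p = ↑q} ∧
        Set.OrdConnected {p : P | ∃ q ∈ S, Λ.toFun ↑p = ↑q}) := by
  exact .inr ⟨Λ.connectedIn_preimage hP hSconn, Λ.ordConnected_preimage hSconv⟩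

end GPM
end

section
/- Let P be a finite poset, K a field, and let S, T ⊆ P be nonempty connected interval-convex subsets with associated convex representations I = I_S and M = I_T. Define the family of linear maps Φ by Φ_p = id_K : I(p) → M(p) for p ∈ S ∩ T and Φ_p = 0 otherwise. Then Φ is a nonzero morphism of representations from I to M if and only if the following three conditions hold: S ∩ T ≠ ∅; for all x ∈ S ∩ T and all y ∈ T with y ≥ x one has y ∈ S; and for all x ∈ S ∩ T and all y ∈ S with y ≤ x one has y ∈ T. -/
namespace GPM

/-- A representation of a poset `P` with values in `K`-vector spaces. -/
structure Rep (P : Type*) [Preorder P] (K : Type*) [Field K] where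
  V : P → Type*
  [addCommGroup : ∀ p, AddCommGroup (V p)]
  [module : ∀ p, Module K (V p)]
  map : ∀ {p q : P}, p ≤ q → V p →ₗ[K] V q
  map_refl : ∀ p : P, map (le_refl p) = LinearMap.id
  map_comp : ∀ {p q r : P} (hpq : p ≤ q) (hqr : q ≤ r),
      (map hqr).comp (map hpq) = map (hpq.trans hqr)

attribute [instance] Rep.addCommGroup Rep.module

/-- A morphism of representations (a natural transformation). -/
structure RepHom {P : Type*} [Preorder P] {K : Type*} [Field K] (M N : Rep P K) where
  app : ∀ p, M.V p →ₗ[K] N.V p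
  natural : ∀ {p q : P} (h : p ≤ q), (N.map h).comp (app p) = (app q).comp (M.map h)

/-- The submodule of `K` underlying the convex representation of `S` at the point `p`:
all of `K` on `S`, and `0` off `S`. -/
noncomputable def convexSub (K : Type*) [Field K] {Q : Type*} (S : Set Q) (p : Q) :
    Submodule K K :=
  @ite _ (p ∈ S) (Classical.dec _) ⊤ ⊥

theorem convexSub_pos (K : Type*) [Field K] {Q : Type*} {S : Set Q} {p : Q} (h : p ∈ S) :
    convexSub K S p = ⊤ := by
  rw [convexSub, if_pos h]

theorem convexSub_neg (K : Type*) [Field K] {Q : Type*} {S : Set Q} {p : Q} (h : p ∉ S) :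
    convexSub K S p = ⊥ := by
  rw [convexSub, if_neg h]

/-- The canonical map between the fibers of the convex representations of `S` and `T`:
the identity of `K` when both fibers are `K`, and zero otherwise. -/
noncomputable def phiMap (K : Type*) [Field K] {Q : Type*} (S T : Set Q) (p q : Q) :
    ↥(convexSub K S p) →ₗ[K] ↥(convexSub K T q) :=
  @dite _ (p ∈ S ∧ q ∈ T) (Classical.dec _)
    (fun h => Submodule.inclusion (le_of_eq (by rw [convexSub_pos K h.1, convexSub_pos K h.2])))
    (fun _ => 0)

theorem phiMap_neg (K : Type*) [Field K] {Q : Type*} {S T : Set Q} {p q : Q}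
    (h : ¬(p ∈ S ∧ q ∈ T)) : phiMap K S T p q = 0 := by
  rw [phiMap, dif_neg h]

/-- The convex representation with support the interval-convex set `S`:
`K` at points of `S`, `0` elsewhere, with identity structure maps inside `S`. -/
noncomputable def convexRep (K : Type*) [Field K] {Q : Type*} [Preorder Q]
    (S : Set Q) (hS : S.OrdConnected) : Rep Q K where
  V p := ↥(convexSub K S p)
  map {p q} _ := phiMap K S S p q
  map_refl p := by
    show phiMap K S S p p = LinearMap.id
    by_cases hp : p ∈ S
    · rw [phiMap, dif_pos ⟨hp, hp⟩]
      rfl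
    · rw [phiMap_neg (K := K) (by tauto)]
      apply LinearMap.ext
      intro x
      have hx : x = 0 := by
        apply Subtype.ext
        have hle : convexSub K S p ≤ ⊥ := le_of_eq (convexSub_neg K hp)
        simpa using hle x.2
      simp [hx]
  map_comp {p q r} hpq hqr := by
    show (phiMap K S S q r).comp (phiMap K S S p q) = phiMap K S S p r
    by_cases hp : p ∈ S
    · by_cases hr : r ∈ S
      · have hq : q ∈ S := hS.out hp hr ⟨hpq, hqr⟩
        rw [phiMap, phiMap, phiMap, dif_pos ⟨hq, hr⟩, dif_pos ⟨hp, hq⟩, dif_pos ⟨hp, hr⟩]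
        rfl
      · rw [phiMap_neg (K := K) (S := S) (T := S) (p := q) (q := r) (by tauto),
          phiMap_neg (K := K) (S := S) (T := S) (p := p) (q := r) (by tauto)]
        simp
    · rw [phiMap_neg (K := K) (S := S) (T := S) (p := p) (q := q) (by tauto),
        phiMap_neg (K := K) (S := S) (T := S) (p := p) (q := r) (by tauto)]
      simp

theorem phiMap_ne_zero_iff (K : Type*) [Field K] {Q : Type*} {S T : Set Q} {p q : Q} :
    phiMap K S T p q ≠ 0 ↔ p ∈ S ∧ q ∈ T := by
  refine ⟨fun h => by_contra fun hn => h (phiMap_neg K hn), fun h h0 => ?_⟩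
  have hmem : (1 : K) ∈ convexSub K S p := by simp [convexSub_pos K h.1]
  have hval : ((phiMap K S T p q ⟨1, hmem⟩ : ↥(convexSub K T q)) : K) = 1 := by
    rw [phiMap, dif_pos h]
    rfl
  rw [h0] at hval
  exact zero_ne_one hval

theorem phiMap_comp_of_mem (K : Type*) [Field K] {Q : Type*} {S T U : Set Q} {p q r : Q}
    (hq : q ∈ T) : (phiMap K T U q r).comp (phiMap K S T p q) = phiMap K S U p r := by
  by_cases hp : p ∈ S
  · by_cases hr : r ∈ U
    · rw [phiMap, phiMap, phiMap, dif_pos ⟨hq, hr⟩, dif_pos ⟨hp, hq⟩, dif_pos ⟨hp, hr⟩]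
      rfl
    · rw [phiMap_neg K (p := q) (by tauto), phiMap_neg K (p := p) (q := r) (by tauto),
        LinearMap.zero_comp]
  · rw [phiMap_neg K (p := p) (q := q) (by tauto), phiMap_neg K (p := p) (q := r) (by tauto),
      LinearMap.comp_zero]

theorem phiMap_comp_of_notMem (K : Type*) [Field K] {Q : Type*} {S T U : Set Q} {p q r : Q}
    (hq : q ∉ T) : (phiMap K T U q r).comp (phiMap K S T p q) = 0 := by
  rw [phiMap_neg K (p := q) (by tauto), LinearMap.zero_comp]

theorem phiMap_natural_iff (K : Type*) [Field K] {Q : Type*} {S T : Set Q} {p q : Q} :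
    (phiMap K T T p q).comp (phiMap K S T p p) = (phiMap K S T q q).comp (phiMap K S S p q) ↔
      (p ∈ S → q ∈ T → (p ∈ T ↔ q ∈ S)) := by
  have hne := phiMap_ne_zero_iff K (S := S) (T := T) (p := p) (q := q)
  by_cases hp : p ∈ T <;> by_cases hq : q ∈ S
  · simp [phiMap_comp_of_mem K hp, phiMap_comp_of_mem K hq, hp, hq]
  · rw [phiMap_comp_of_mem K hp, phiMap_comp_of_notMem K hq]
    tauto
  · rw [phiMap_comp_of_notMem K hp, phiMap_comp_of_mem K hq, eq_comm]
    tauto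
  · simp [phiMap_comp_of_notMem K hp, phiMap_comp_of_notMem K hq, hp, hq]

/-- Let `S`, `T` be nonempty connected interval-convex subsets of a
finite poset `P`, with convex representations `I = I_S`, `M = I_T`.  The family `Φ`
with `Φ_p = id_K` on `S ∩ T` and `Φ_p = 0` elsewhere is a nonzero morphism of
representations from `I` to `M` iff `S ∩ T ≠ ∅`, every `y ∈ T` above a point of
`S ∩ T` lies in `S`, and every `y ∈ S` below a point of `S ∩ T` lies in `T`. -/
theorem statement5 {P : Type*} [PartialOrder P] [Finite P] {K : Type*} [Field K]
    (S T : Set P)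
    (hSne : S.Nonempty) (hSconn : ConnectedIn S) (hSconv : S.OrdConnected)
    (hTne : T.Nonempty) (hTconn : ConnectedIn T) (hTconv : T.OrdConnected) :
    ((∀ (p q : P) (h : p ≤ q),
        ((convexRep K T hTconv).map h).comp (phiMap K S T p p) =
          (phiMap K S T q q).comp ((convexRep K S hSconv).map h)) ∧
      (∃ p : P, phiMap K S T p p ≠ 0))
    ↔ ((S ∩ T).Nonempty ∧
        (∀ x ∈ S ∩ T, ∀ y ∈ T, x ≤ y → y ∈ S) ∧
        (∀ x ∈ S ∩ T, ∀ y ∈ S, y ≤ x → y ∈ T)) := by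
  have hnat : ∀ (p q : P) (h : p ≤ q),
      ((convexRep K T hTconv).map h).comp (phiMap K S T p p) =
        (phiMap K S T q q).comp ((convexRep K S hSconv).map h) ↔
      (p ∈ S → q ∈ T → (p ∈ T ↔ q ∈ S)) := fun _ _ _ => phiMap_natural_iff K
  simp only [hnat, phiMap_ne_zero_iff]
  constructor
  · rintro ⟨h, hne⟩
    exact ⟨hne, fun x hx y hy hxy => (h x y hxy hx.1 hy).1 hx.2,
      fun x hx y hy hyx => (h y x hyx hy hx.2).2 hx.1⟩
  · rintro ⟨hne, hup, hdown⟩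
    exact ⟨fun p q h hp hq => ⟨fun hpT => hup p ⟨hp, hpT⟩ q hq h,
      fun hqS => hdown q ⟨hqS, hq⟩ p hp h⟩, hne⟩

end GPM
end

section
/- Let P be a finite poset, K a field, let I and M be convex representations of P with supports S_I and S_M, and let S ⊆ S_I ∩ S_M be nonempty and interval-convex. Then there exists a morphism of representations f : I → M whose image has support exactly S (i.e. the image of the component f_p is nonzero precisely when p ∈ S) if and only if: (a) for all x ∈ S and all y ∈ S_I with y ≤ x, one has y ∈ S; and (b) for all x ∈ S and all y ∈ S_M with y ≥ x, one has y ∈ S. -/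
namespace GPM

theorem RepHom.map_app_apply {P : Type*} [Preorder P] {K : Type*} [Field K] {M N : Rep P K}
    (f : RepHom M N) {p q : P} (h : p ≤ q) (v : M.V p) :
    N.map h (f.app p v) = f.app q (M.map h v) :=
  LinearMap.congr_fun (f.natural h) v

theorem RepHom.app_map_eq_zero {P : Type*} [Preorder P] {K : Type*} [Field K] {M N : Rep P K}
    (f : RepHom M N) {p q : P} (h : p ≤ q) (hp : f.app p = 0) (v : M.V p) :
    f.app q (M.map h v) = 0 := by
  rw [← f.map_app_apply, hp, LinearMap.zero_apply, map_zero]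

theorem RepHom.map_app_eq_zero {P : Type*} [Preorder P] {K : Type*} [Field K] {M N : Rep P K}
    (f : RepHom M N) {p q : P} (h : p ≤ q) (hq : f.app q = 0) (v : M.V p) :
    N.map h (f.app p v) = 0 := by
  rw [f.map_app_apply, hq, LinearMap.zero_apply]

theorem coe_phiMap (K : Type*) [Field K] {Q : Type*} (S T : Set Q) [DecidablePred (· ∈ T)]
    (p q : Q) (x : convexSub K S p) :
    (phiMap K S T p q x : K) = if q ∈ T then (x : K) else 0 := by
  by_cases hp : p ∈ S
  · by_cases hq : q ∈ T
    · rw [phiMap, dif_pos ⟨hp, hq⟩, if_pos hq]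
      rfl
    · rw [phiMap_neg K (fun h => hq h.2), if_neg hq]
      rfl
  · have hx : (x : K) = 0 := by
      have hle : convexSub K S p ≤ ⊥ := (convexSub_neg K hp).le
      simpa using hle x.2
    rw [phiMap_neg K (fun h => hp h.1), hx, ite_self]
    rfl

/-- The morphism of convex representations that is the identity of `K` on `S` and zero off `S`. -/
noncomputable def convexHom (K : Type*) [Field K] {Q : Type*} [Preorder Q] {SI SM S : Set Q}
    (hI : SI.OrdConnected) (hM : SM.OrdConnected) (hsub : S ⊆ SI ∩ SM)
    (hdown : ∀ x ∈ S, ∀ y ∈ SI, y ≤ x → y ∈ S) (hup : ∀ x ∈ S, ∀ y ∈ SM, x ≤ y → y ∈ S) :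
    RepHom (convexRep K SI hI) (convexRep K SM hM) where
  app p := @ite _ (p ∈ S) (Classical.dec _) (phiMap K SI SM p p) 0
  natural {p q} h := by
    classical
    refine LinearMap.ext fun (x : convexSub K SI p) => Subtype.ext ?_
    change (phiMap K SM SM p q ((ite (p ∈ S) (phiMap K SI SM p p) 0) x) : K) =
      ((ite (q ∈ S) (phiMap K SI SM q q) 0) (phiMap K SI SI p q x) : convexSub K SM q)
    by_cases hp : p ∈ S
    · by_cases hq : q ∈ S
      · simp [hp, hq, coe_phiMap, (hsub hp).2, (hsub hq).1, (hsub hq).2]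
      · have hqM : q ∉ SM := fun hqM => hq (hup p hp q hqM h)
        simp [hq, coe_phiMap, hqM]
    · by_cases hq : q ∈ S
      · have hpI : p ∉ SI := fun hpI => hp (hdown q hq p hpI h)
        simp [hp, hq, phiMap_neg K (fun h : p ∈ SI ∧ q ∈ SI => hpI h.1)]
      · simp [hp, hq]

/-- Let `I`, `M` be convex representations of a finite poset `P` with
supports `SI`, `SM`, and let `S ⊆ SI ∩ SM` be nonempty and interval-convex.  There is a
morphism `f : I → M` whose components have nonzero image precisely on `S` iff `S` is
downward closed in `SI` and upward closed in `SM`. -/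
theorem statement6 {P : Type*} [PartialOrder P] [Finite P] {K : Type*} [Field K]
    (SI SM S : Set P)
    (hIne : SI.Nonempty) (hIconn : ConnectedIn SI) (hIconv : SI.OrdConnected)
    (hMne : SM.Nonempty) (hMconn : ConnectedIn SM) (hMconv : SM.OrdConnected)
    (hSne : S.Nonempty) (hSconv : S.OrdConnected) (hsub : S ⊆ SI ∩ SM) :
    (∃ f : RepHom (convexRep K SI hIconv) (convexRep K SM hMconv),
        ∀ p : P, LinearMap.range (f.app p) ≠ ⊥ ↔ p ∈ S)
    ↔ ((∀ x ∈ S, ∀ y ∈ SI, y ≤ x → y ∈ S) ∧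
        (∀ x ∈ S, ∀ y ∈ SM, x ≤ y → y ∈ S)) := by
  classical
  simp only [ne_eq, LinearMap.range_eq_bot]
  constructor
  · rintro ⟨f, hf⟩
    refine ⟨fun x hx y hy hyx => ?_, fun x hx y hy hxy => ?_⟩
    · rw [← hf] at hx ⊢
      refine fun hfy => hx (LinearMap.ext fun (w : convexSub K SI x) => ?_)
      have hxI : x ∈ SI := (hsub ((hf x).1 hx)).1
      let v : convexSub K SI y := ⟨w, by rw [convexSub_pos K hy]; trivial⟩
      have hv : phiMap K SI SI y x v = w :=
        Subtype.ext (by rw [coe_phiMap, if_pos hxI])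
      rw [← hv]
      exact f.app_map_eq_zero hyx hfy v
    · rw [← hf] at hx ⊢
      refine fun hfy => hx (LinearMap.ext fun v => Subtype.ext ?_)
      have hcoe := coe_phiMap K SM SM x y (f.app x v)
      rw [if_pos hy] at hcoe
      exact hcoe.symm.trans (congrArg Subtype.val (f.map_app_eq_zero hxy hfy v))
  · rintro ⟨hdown, hup⟩
    refine ⟨convexHom K hIconv hMconv hsub hdown hup, fun p => ⟨fun h => ?_, fun hp h => ?_⟩⟩
    · by_contra hp
      exact h (if_neg hp)
    · have hzero : phiMap K SI SM p p = 0 := (if_pos hp).symm.trans h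
      have hone := coe_phiMap K SI SM p p ⟨1, by rw [convexSub_pos K (hsub hp).1]; trivial⟩
      rw [hzero, if_pos (hsub hp).2] at hone
      exact zero_ne_one hone

end GPM
end

section
/- Let P = {0, 1, …, n} be a finite totally ordered set, K a field, and let I and J be convex representations of P with supports the intervals [x, X] and [y, Y] respectively. Then there exists a nonzero morphism of representations from I to J if and only if y ≤ x ≤ Y ≤ X. -/
namespace GPM

theorem phiMap_coe (K : Type*) [Field K] {Q : Type*} {S T : Set Q} {p q : Q}
    (hp : p ∈ S) (hq : q ∈ T) (v : ↥(convexSub K S p)) : (phiMap K S T p q v : K) = v := by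
  rw [phiMap, dif_pos ⟨hp, hq⟩]
  rfl

theorem phiMap_comp (K : Type*) [Field K] {Q : Type*} {S T U : Set Q} {p q r : Q}
    (h : p ∈ S → r ∈ U → q ∈ T) :
    (phiMap K T U q r).comp (phiMap K S T p q) = phiMap K S U p r := by
  by_cases hp : p ∈ S
  · by_cases hr : r ∈ U
    · ext v
      rw [LinearMap.comp_apply, phiMap_coe K (h hp hr) hr, phiMap_coe K hp (h hp hr),
        phiMap_coe K hp hr]
    · rw [phiMap_neg K (fun h => hr h.2), phiMap_neg K (fun h => hr h.2), LinearMap.zero_comp]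
  · rw [phiMap_neg K (S := S) (T := T) (fun h => hp h.1), phiMap_neg K (fun h => hp h.1),
      LinearMap.comp_zero]

theorem mem_of_ne_zero (K : Type*) [Field K] {Q : Type*} {S : Set Q} {p : Q}
    {v : ↥(convexSub K S p)} (hv : v ≠ 0) : p ∈ S := by
  by_contra hp
  have hle : convexSub K S p ≤ ⊥ := (convexSub_neg K hp).le
  exact hv (Subtype.ext ((Submodule.mem_bot K).1 (hle v.2)))

/-- For convex representations `I`, `J` of the finite totally ordered
set `{0, …, n}` with supports `[x, X]` and `[y, Y]`, there is a nonzero morphism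
`I → J` iff `y ≤ x ≤ Y ≤ X`. -/
theorem statement10 (n : ℕ) {K : Type*} [Field K]
    (x X y Y : Fin (n + 1)) (hxX : x ≤ X) (hyY : y ≤ Y) :
    (∃ f : RepHom (convexRep K (Set.Icc x X) Set.ordConnected_Icc)
        (convexRep K (Set.Icc y Y) Set.ordConnected_Icc),
      ∃ p, f.app p ≠ 0)
    ↔ (y ≤ x ∧ x ≤ Y ∧ Y ≤ X) := by
  constructor
  · rintro ⟨f, p, hf⟩
    obtain ⟨v, hv⟩ : ∃ v, f.app p v ≠ 0 := by
      by_contra! h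
      exact hf (LinearMap.ext h)
    have hpS : p ∈ Set.Icc x X := by
      refine mem_of_ne_zero K (v := v) fun h => hv ?_
      rw [h]
      exact map_zero (f.app p)
    have hpT : p ∈ Set.Icc y Y := mem_of_ne_zero K (v := f.app p v) hv
    have nat : ∀ {a b : Fin (n + 1)} (_ : a ≤ b) (u : ↥(convexSub K (Set.Icc x X) a)),
        phiMap K (Set.Icc y Y) (Set.Icc y Y) a b (f.app a u) =
          f.app b (phiMap K (Set.Icc x X) (Set.Icc x X) a b u) :=
      fun h u => LinearMap.congr_fun (f.natural h) u
    refine ⟨?_, hpS.1.trans hpT.2, ?_⟩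
    · by_contra hyx
      have hxS : x ∈ Set.Icc x X := ⟨le_rfl, hxX⟩
      have hu := nat hpS.1 (phiMap K (Set.Icc x X) (Set.Icc x X) p x v)
      rw [phiMap_neg K (S := Set.Icc y Y) (fun h => hyx h.1.1)] at hu
      have hback : phiMap K (Set.Icc x X) (Set.Icc x X) x p
          (phiMap K (Set.Icc x X) (Set.Icc x X) p x v) = v :=
        Subtype.ext ((phiMap_coe K hxS hpS _).trans (phiMap_coe K hpS hxS v))
      rw [hback] at hu
      exact hv hu.symm
    · by_contra hYX
      have hYT : Y ∈ Set.Icc y Y := ⟨hyY, le_rfl⟩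
      have hu := nat hpT.2 v
      rw [phiMap_neg K (S := Set.Icc x X) (fun h => hYX h.2.2)] at hu
      have hzero : phiMap K (Set.Icc y Y) (Set.Icc y Y) p Y (f.app p v) = 0 :=
        hu.trans (map_zero (f.app Y))
      refine hv (Subtype.ext ?_)
      exact (phiMap_coe K hpT hYT (f.app p v)).symm.trans (congrArg Subtype.val hzero)
  · rintro ⟨hyx, hxY, hYX⟩
    refine ⟨⟨fun p => phiMap K (Set.Icc x X) (Set.Icc y Y) p p, fun {p q} h => ?_⟩, x, ?_⟩
    · have hleft : p ∈ Set.Icc x X → q ∈ Set.Icc y Y → p ∈ Set.Icc y Y :=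
        fun hp hq => ⟨hyx.trans hp.1, h.trans hq.2⟩
      have hright : p ∈ Set.Icc x X → q ∈ Set.Icc y Y → q ∈ Set.Icc x X :=
        fun hp hq => ⟨hp.1.trans h, hq.2.trans hYX⟩
      exact (phiMap_comp K hleft).trans (phiMap_comp K hright).symm
    · intro h
      have hxS : x ∈ Set.Icc x X := ⟨le_rfl, hxX⟩
      have hone : (1 : K) ∈ convexSub K (Set.Icc x X) x := by
        rw [convexSub_pos K hxS]
        exact Submodule.mem_top
      have h1 := phiMap_coe K (T := Set.Icc y Y) hxS ⟨hyx, hxY⟩ ⟨1, hone⟩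
      have h0 := congrArg Subtype.val (LinearMap.congr_fun h ⟨1, hone⟩)
      exact one_ne_zero (h1.symm.trans h0)

end GPM
end
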